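/- Let d ≥ 1 and s < 0, and assume in addition s ≤ −1/2 when d = 1. Let u₀, u₁ : ℤ^d → ℂ satisfy u_j(−n) = conj(u_j(n)) for j = 0,1 and suppose the data are smooth, i.e. for every k ∈ ℕ one has sup_{n∈ℤ^d} ⟨n⟩^k (|u₀(n)| + |u₁(n)|) < ∞. Then for every positive integer m there exist sequences v₀, v₁ : ℤ^d → ℂ with v_j(−n) = conj(v_j(n)) and Σ_{n∈ℤ^d}(|v₀(n)| + ⟨n⟩^{−1}|v₁(n)|) < ∞, a time t_m ∈ (0, 1/m), and a solution u of the cubic NLW on [0, t_m] with data (v₀, v₁) in the FL¹ Duhamel sense, such that ‖(v₀,v₁) − (u₀,u₁)‖_{H^s×H^{s−1}} < 1/m and ‖u(t_m)‖_{H^s} > m. -/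

import Mathlib

open scoped BigOperators

noncomputable section

/-- Japanese bracket `⟨n⟩ = √(1+|n|²)` for `n ∈ ℤ^d`. -/
def jap {d : ℕ} (n : Fin d → ℤ) : ℝ := Real.sqrt (1 + ∑ i, ((n i : ℝ)) ^ 2)

/-- Discrete convolution on `ℤ^d`. -/
def dconv {d : ℕ} (f g : (Fin d → ℤ) → ℂ) : (Fin d → ℤ) → ℂ :=
  fun n => ∑' m, f m * g (n - m)

/-- Triple (cubic) convolution. -/
def dcube {d : ℕ} (f : (Fin d → ℤ) → ℂ) : (Fin d → ℤ) → ℂ := dconv (dconv f f) f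

/-- `u` is a continuous map from `I` into `ℓ¹(ℤ^d)`. -/
def ContL1On {d : ℕ} (I : Set ℝ) (u : ℝ → (Fin d → ℤ) → ℂ) : Prop :=
  (∀ t ∈ I, Summable fun n => ‖u t n‖) ∧
  ∀ t ∈ I, ∀ ε > (0 : ℝ), ∃ δ > (0 : ℝ), ∀ s ∈ I, |s - t| < δ →
    (∑' n, ‖u s n - u t n‖) < ε

/-- `u` solves the cubic NLW on `I` with data `(v₀, v₁)` in the `FL¹` Duhamel sense. -/
def SolvesNLW {d : ℕ} (I : Set ℝ) (v₀ v₁ : (Fin d → ℤ) → ℂ)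
    (u : ℝ → (Fin d → ℤ) → ℂ) : Prop :=
  ContL1On I u ∧
  ∀ t ∈ I, ∀ n : Fin d → ℤ,
    u t n = (Real.cos (t * jap n) : ℂ) * v₀ n
      + ((Real.sin (t * jap n) / jap n : ℝ) : ℂ) * v₁ n
      - ∫ s in (0 : ℝ)..t,
          ((Real.sin ((t - s) * jap n) / jap n : ℝ) : ℂ) * dcube (u s) n

/-- The square of the `H^σ` norm of a sequence of Fourier coefficients. -/
def hsum {d : ℕ} (σ : ℝ) (v : (Fin d → ℤ) → ℂ) : ℝ :=
  ∑' n, (jap n) ^ (2 * σ) * ‖v n‖ ^ 2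

end

/-- The space `ℓ¹(ℤ^d)`. -/
noncomputable abbrev L1Seq (d : ℕ) := lp (fun _ : Fin d → ℤ => ℂ) 1

lemma one_le_jap {d : ℕ} (n : Fin d → ℤ) : 1 ≤ jap n := by
  rw [jap, Real.one_le_sqrt]
  have : 0 ≤ ∑ i, ((n i : ℝ)) ^ 2 := by positivity
  linarith

lemma jap_pos {d : ℕ} (n : Fin d → ℤ) : 0 < jap n := zero_lt_one.trans_le (one_le_jap n)

lemma jap_neg {d : ℕ} (n : Fin d → ℤ) : jap (-n) = jap n := by simp [jap]

lemma jap_zero {d : ℕ} : jap (0 : Fin d → ℤ) = 1 := by simp [jap]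

lemma summable_jap_inv_pow (d : ℕ) : Summable fun n : Fin d → ℤ => (jap n ^ (2 * d))⁻¹ := by
  have h1 : Summable fun k : ℤ => (1 + (k : ℝ) ^ 2)⁻¹ := by
    refine Summable.of_norm_bounded_eventually
      (g := fun k : ℤ => 1 / (k : ℝ) ^ 2) (Real.summable_one_div_int_pow.mpr one_lt_two) ?_
    have : ({0}ᶜ : Set ℤ) ∈ Filter.cofinite :=
      (Set.finite_singleton 0).compl_mem_cofinite
    filter_upwards [this] with k hk
    have hk0 : (k : ℝ) ≠ 0 := by exact_mod_cast hk
    have : 0 < (k : ℝ) ^ 2 := by positivity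
    rw [Real.norm_of_nonneg (by positivity), inv_eq_one_div]
    gcongr
    linarith
  have h2 : Summable fun n : Fin d → ℤ => ∏ i, (1 + (n i : ℝ) ^ 2)⁻¹ := by
    refine summable_of_sum_le (c := ∏ _i : Fin d, ∑' k : ℤ, (1 + (k : ℝ) ^ 2)⁻¹)
      (fun n => by positivity) fun s => ?_
    classical
    calc ∑ n ∈ s, ∏ i, (1 + (n i : ℝ) ^ 2)⁻¹
        ≤ ∑ n ∈ Fintype.piFinset fun i => s.image fun n : Fin d → ℤ => n i,
            ∏ i, (1 + (n i : ℝ) ^ 2)⁻¹ := by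
          refine Finset.sum_le_sum_of_subset_of_nonneg (fun n hn => ?_) fun _ _ _ => by positivity
          rw [Fintype.mem_piFinset]
          exact fun i => Finset.mem_image_of_mem (fun n => n i) hn
      _ = ∏ i, ∑ k ∈ s.image fun n : Fin d → ℤ => n i, (1 + (k : ℝ) ^ 2)⁻¹ :=
          (Finset.prod_univ_sum (fun i => s.image fun n => n i)
            fun _ (k : ℤ) => (1 + (k : ℝ) ^ 2)⁻¹).symm
      _ ≤ _ := Finset.prod_le_prod (fun _ _ => Finset.sum_nonneg fun _ _ => by positivity)
          fun _ _ => h1.sum_le_tsum _ fun _ _ => by positivity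
  refine Summable.of_nonneg_of_le (fun n => by have := jap_pos n; positivity) (fun n => ?_) h2
  have hj : ∀ i, 1 + (n i : ℝ) ^ 2 ≤ jap n ^ 2 := fun i => by
    rw [jap, Real.sq_sqrt (by positivity)]
    gcongr
    exact Finset.single_le_sum (f := fun i => (n i : ℝ) ^ 2) (fun _ _ => by positivity)
      (Finset.mem_univ i)
  rw [Finset.prod_inv_distrib]
  refine inv_anti₀ (by positivity) ?_
  calc ∏ i, (1 + (n i : ℝ) ^ 2) ≤ ∏ _i : Fin d, jap n ^ 2 :=
        Finset.prod_le_prod (fun _ _ => by positivity) fun i _ => hj i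
    _ = jap n ^ (2 * d) := by simp [pow_mul]

/-- Rapidly decaying sequences are summable against the weight `⟨n⟩`. -/
lemma summable_jap_mul_of_decay {d : ℕ} {f : (Fin d → ℤ) → ℂ}
    (h : ∀ k : ℕ, ∃ C : ℝ, ∀ n, jap n ^ k * ‖f n‖ ≤ C) : Summable fun n => jap n * ‖f n‖ := by
  obtain ⟨C, hC⟩ := h (2 * d + 1)
  refine Summable.of_nonneg_of_le (fun n => by have := jap_pos n; positivity) (fun n => ?_)
    ((summable_jap_inv_pow d).mul_left C)
  have := jap_pos n
  rw [← div_eq_mul_inv, le_div_iff₀ (by positivity)]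
  calc jap n * ‖f n‖ * jap n ^ (2 * d) = jap n ^ (2 * d + 1) * ‖f n‖ := by ring
    _ ≤ C := hC n

lemma norm_eq_tsum_norm {d : ℕ} (x : L1Seq d) : ‖x‖ = ∑' n, ‖x n‖ := by
  simpa using lp.norm_eq_tsum_rpow (p := 1) (by simp) x

lemma summable_norm_coe {d : ℕ} (x : L1Seq d) : Summable fun n => ‖x n‖ := by
  simpa using (lp.memℓp x).summable (p := 1) (by simp)

/-- The element of `ℓ¹(ℤ^d)` with prescribed coefficients (zero if these are not summable). -/
noncomputable def toL1Seq {d : ℕ} (f : (Fin d → ℤ) → ℂ) : L1Seq d :=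
  open Classical in if h : Memℓp f 1 then ⟨f, h⟩ else 0

lemma coe_toL1Seq {d : ℕ} {f : (Fin d → ℤ) → ℂ} (h : Summable fun n => ‖f n‖) :
    ⇑(toL1Seq f) = f := by
  have : Memℓp f 1 := memℓp_gen (by simpa using h)
  rw [toL1Seq, dif_pos this]

lemma norm_toL1Seq {d : ℕ} {f : (Fin d → ℤ) → ℂ} (h : Summable fun n => ‖f n‖) :
    ‖toL1Seq f‖ = ∑' n, ‖f n‖ := by
  rw [norm_eq_tsum_norm, coe_toL1Seq h]

/-! ### Convolution -/

lemma summable_prod_conv {d : ℕ} {f g : (Fin d → ℤ) → ℝ} (hf : Summable f) (hg : Summable g)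
    (hf0 : 0 ≤ f) (hg0 : 0 ≤ g) :
    Summable fun q : (Fin d → ℤ) × (Fin d → ℤ) => f q.1 * g (q.2 - q.1) := by
  let e : (Fin d → ℤ) × (Fin d → ℤ) ≃ (Fin d → ℤ) × (Fin d → ℤ) :=
    { toFun := fun q => (q.1, q.2 - q.1)
      invFun := fun q => (q.1, q.2 + q.1)
      left_inv := fun q => by simp
      right_inv := fun q => by simp }
  exact e.summable_iff.mpr (hf.mul_of_nonneg hg hf0 hg0)

lemma tsum_conv {d : ℕ} {f g : (Fin d → ℤ) → ℝ} (hf : Summable f) (hg : Summable g)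
    (hf0 : 0 ≤ f) (hg0 : 0 ≤ g) :
    ∑' n, ∑' m, f m * g (n - m) = (∑' n, f n) * ∑' n, g n := by
  have h := summable_prod_conv hf hg hf0 hg0
  calc ∑' n, ∑' m, f m * g (n - m) = ∑' m, ∑' n, f m * g (n - m) := (Summable.tsum_comm h.prod_symm).symm
    _ = ∑' m, f m * ∑' n, g n := by
        refine tsum_congr fun m => ?_
        rw [tsum_mul_left, ← (Equiv.subRight m).tsum_eq g]
        rfl
    _ = _ := tsum_mul_right

section

variable {d : ℕ} {f g : (Fin d → ℤ) → ℂ}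

lemma summable_conv_term (hf : Summable fun n => ‖f n‖) (hg : Summable fun n => ‖g n‖)
    (n : Fin d → ℤ) : Summable fun m => f m * g (n - m) := by
  refine Summable.of_norm ?_
  simpa using (summable_prod_conv hf hg (fun _ => norm_nonneg _)
    fun _ => norm_nonneg _).prod_symm.prod_factor n

lemma norm_dconv_apply_le (hf : Summable fun n => ‖f n‖) (hg : Summable fun n => ‖g n‖)
    (n : Fin d → ℤ) : ‖dconv f g n‖ ≤ ∑' m, ‖f m‖ * ‖g (n - m)‖ := by
  refine (norm_tsum_le_tsum_norm (summable_conv_term hf hg n).norm).trans_eq ?_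
  simp

lemma summable_norm_dconv (hf : Summable fun n => ‖f n‖) (hg : Summable fun n => ‖g n‖) :
    Summable fun n => ‖dconv f g n‖ :=
  Summable.of_nonneg_of_le (fun _ => norm_nonneg _) (norm_dconv_apply_le hf hg)
    (summable_prod_conv hf hg (fun _ => norm_nonneg _) fun _ => norm_nonneg _).prod_symm.prod

lemma tsum_norm_dconv_le (hf : Summable fun n => ‖f n‖) (hg : Summable fun n => ‖g n‖) :
    ∑' n, ‖dconv f g n‖ ≤ (∑' n, ‖f n‖) * ∑' n, ‖g n‖ := by
  rw [← tsum_conv hf hg (fun _ => norm_nonneg _) fun _ => norm_nonneg _]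
  exact (summable_norm_dconv hf hg).tsum_le_tsum (norm_dconv_apply_le hf hg)
    (summable_prod_conv hf hg (fun _ => norm_nonneg _) fun _ => norm_nonneg _).prod_symm.prod

end

/-- Convolution on `ℓ¹(ℤ^d)`. -/
noncomputable def conv {d : ℕ} (x y : L1Seq d) : L1Seq d := toL1Seq (dconv x y)

section

variable {d : ℕ} (x y z : L1Seq d)

lemma coe_conv : ⇑(conv x y) = dconv x y :=
  coe_toL1Seq (summable_norm_dconv (summable_norm_coe x) (summable_norm_coe y))

lemma norm_conv_le : ‖conv x y‖ ≤ ‖x‖ * ‖y‖ := by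
  rw [norm_eq_tsum_norm, norm_eq_tsum_norm, norm_eq_tsum_norm, coe_conv]
  exact tsum_norm_dconv_le (summable_norm_coe x) (summable_norm_coe y)

lemma conv_sub : conv x (y - z) = conv x y - conv x z := by
  apply lp.ext
  rw [lp.coeFn_sub, coe_conv, coe_conv, coe_conv]
  ext n
  have hy := summable_conv_term (summable_norm_coe x) (summable_norm_coe y) n
  have hz := summable_conv_term (summable_norm_coe x) (summable_norm_coe z) n
  simp only [dconv, Pi.sub_apply, lp.coeFn_sub]
  rw [← hy.tsum_sub hz]
  exact tsum_congr fun m => by ring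

lemma sub_conv : conv (x - y) z = conv x z - conv y z := by
  apply lp.ext
  rw [lp.coeFn_sub, coe_conv, coe_conv, coe_conv]
  ext n
  have hy := summable_conv_term (summable_norm_coe x) (summable_norm_coe z) n
  have hz := summable_conv_term (summable_norm_coe y) (summable_norm_coe z) n
  simp only [dconv, Pi.sub_apply, lp.coeFn_sub]
  rw [← hy.tsum_sub hz]
  exact tsum_congr fun m => by ring

end

/-- The cubic nonlinearity on `ℓ¹(ℤ^d)`. -/
noncomputable def cube {d : ℕ} (x : L1Seq d) : L1Seq d := conv (conv x x) x

lemma coe_cube {d : ℕ} (x : L1Seq d) : ⇑(cube x) = dcube x := by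
  rw [cube, coe_conv, coe_conv, dcube]

lemma norm_cube_sub_le {d : ℕ} {x y : L1Seq d} {R : ℝ} (hx : ‖x‖ ≤ R) (hy : ‖y‖ ≤ R) :
    ‖cube x - cube y‖ ≤ 3 * R ^ 2 * ‖x - y‖ := by
  have hR : 0 ≤ R := (norm_nonneg x).trans hx
  have e : cube x - cube y =
      conv (conv (x - y) x) x + conv (conv y (x - y)) x + conv (conv y y) (x - y) := by
    simp only [cube, conv_sub, sub_conv]
    abel
  rw [e]
  have h1 : ‖conv (conv (x - y) x) x‖ ≤ ‖x - y‖ * R * R :=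
    (norm_conv_le _ _).trans (by gcongr; exact (norm_conv_le _ _).trans (by gcongr))
  have h2 : ‖conv (conv y (x - y)) x‖ ≤ R * ‖x - y‖ * R :=
    (norm_conv_le _ _).trans (by gcongr; exact (norm_conv_le _ _).trans (by gcongr))
  have h3 : ‖conv (conv y y) (x - y)‖ ≤ R * R * ‖x - y‖ :=
    (norm_conv_le _ _).trans (by gcongr; exact (norm_conv_le _ _).trans (by gcongr))
  calc _ ≤ _ := norm_add₃_le
    _ ≤ 3 * R ^ 2 * ‖x - y‖ := by linarith

lemma norm_cube_le {d : ℕ} (x : L1Seq d) : ‖cube x‖ ≤ ‖x‖ ^ 3 := by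
  calc _ ≤ ‖conv x x‖ * ‖x‖ := norm_conv_le _ _
    _ ≤ ‖x‖ * ‖x‖ * ‖x‖ := by gcongr; exact norm_conv_le _ _
    _ = _ := by ring

lemma continuous_cube {d : ℕ} : Continuous (cube : L1Seq d → L1Seq d) := by
  refine continuous_iff_continuousAt.mpr fun x => ?_
  refine tendsto_iff_norm_sub_tendsto_zero.mpr ?_
  have hb : ∀ᶠ y in nhds x, ‖cube y - cube x‖ ≤ 3 * (‖x‖ + 1) ^ 2 * ‖y - x‖ := by
    filter_upwards [Metric.ball_mem_nhds x one_pos] with y hy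
    rw [mem_ball_iff_norm] at hy
    have := norm_le_norm_add_norm_sub x y
    rw [norm_sub_rev] at this
    exact norm_cube_sub_le (by linarith) (by linarith)
  refine squeeze_zero' (.of_forall fun _ => norm_nonneg _) hb ?_
  have : Continuous fun y : L1Seq d => 3 * (‖x‖ + 1) ^ 2 * ‖y - x‖ := by fun_prop
  simpa using this.tendsto x

/-! ### Linear propagators -/

lemma summable_norm_real_mul {d : ℕ} {c : (Fin d → ℤ) → ℝ} {K : ℝ} (hc : ∀ n, |c n| ≤ K)
    {f : (Fin d → ℤ) → ℂ} (hf : Summable fun n => ‖f n‖) :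
    Summable fun n => ‖(c n : ℂ) * f n‖ := by
  refine Summable.of_nonneg_of_le (fun _ => norm_nonneg _) (fun n => ?_) (hf.mul_left K)
  rw [norm_mul, Complex.norm_real]
  exact mul_le_mul_of_nonneg_right (hc n) (norm_nonneg _)

lemma tsum_norm_real_mul_le {d : ℕ} {c : (Fin d → ℤ) → ℝ} {K : ℝ} (hc : ∀ n, |c n| ≤ K)
    {f : (Fin d → ℤ) → ℂ} (hf : Summable fun n => ‖f n‖) :
    ∑' n, ‖(c n : ℂ) * f n‖ ≤ K * ∑' n, ‖f n‖ := by
  rw [← tsum_mul_left]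
  refine (summable_norm_real_mul hc hf).tsum_le_tsum (fun n => ?_) (hf.mul_left K)
  rw [norm_mul, Complex.norm_real]
  exact mul_le_mul_of_nonneg_right (hc n) (norm_nonneg _)

lemma abs_sin_mul_div_sub_le {j : ℝ} (hj : 0 < j) (t t' : ℝ) :
    |Real.sin (t * j) / j - Real.sin (t' * j) / j| ≤ |t - t'| := by
  rw [← sub_div, abs_div, abs_of_pos hj, div_le_iff₀ hj]
  refine (Real.abs_sin_sub_sin_le _ _).trans_eq ?_
  rw [← sub_mul, abs_mul, abs_of_pos hj]

lemma abs_sin_mul_div_le {j : ℝ} (hj : 0 < j) (t : ℝ) : |Real.sin (t * j) / j| ≤ |t| := by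
  simpa using abs_sin_mul_div_sub_le hj t 0

/-- The Fourier multiplier `sin(t⟨∇⟩)/⟨∇⟩` on `ℓ¹(ℤ^d)`. -/
noncomputable def sinMul {d : ℕ} (t : ℝ) (x : L1Seq d) : L1Seq d :=
  toL1Seq fun n => ((Real.sin (t * jap n) / jap n : ℝ) : ℂ) * x n

section

variable {d : ℕ}

lemma coe_sinMul (t : ℝ) (x : L1Seq d) :
    ⇑(sinMul t x) = fun n => ((Real.sin (t * jap n) / jap n : ℝ) : ℂ) * x n :=
  coe_toL1Seq (summable_norm_real_mul (fun n => abs_sin_mul_div_le (jap_pos n) t)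
    (summable_norm_coe x))

lemma norm_sinMul_le (t : ℝ) (x : L1Seq d) : ‖sinMul t x‖ ≤ |t| * ‖x‖ := by
  rw [norm_eq_tsum_norm, norm_eq_tsum_norm, coe_sinMul]
  exact tsum_norm_real_mul_le (fun n => abs_sin_mul_div_le (jap_pos n) t) (summable_norm_coe x)

lemma sinMul_sub (t : ℝ) (x y : L1Seq d) : sinMul t (x - y) = sinMul t x - sinMul t y := by
  apply lp.ext
  rw [lp.coeFn_sub, coe_sinMul, coe_sinMul, coe_sinMul]
  ext n
  simp only [Pi.sub_apply, lp.coeFn_sub]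
  ring

lemma norm_sinMul_sub_le (t t' : ℝ) (x : L1Seq d) :
    ‖sinMul t x - sinMul t' x‖ ≤ |t - t'| * ‖x‖ := by
  rw [norm_eq_tsum_norm, norm_eq_tsum_norm, lp.coeFn_sub, coe_sinMul, coe_sinMul]
  refine le_of_eq_of_le (tsum_congr fun n => ?_)
    (tsum_norm_real_mul_le (fun n => abs_sin_mul_div_sub_le (jap_pos n) t t')
      (summable_norm_coe x))
  rw [Pi.sub_apply, ← sub_mul, ← Complex.ofReal_sub]

lemma continuous_sinMul : Continuous fun p : ℝ × L1Seq d => sinMul p.1 p.2 := by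
  refine continuous_iff_continuousAt.mpr fun p => ?_
  refine tendsto_iff_norm_sub_tendsto_zero.mpr ?_
  have hb : ∀ q : ℝ × L1Seq d, ‖sinMul q.1 q.2 - sinMul p.1 p.2‖ ≤
      |q.1| * ‖q.2 - p.2‖ + |q.1 - p.1| * ‖p.2‖ := fun q => by
    have e : sinMul q.1 q.2 - sinMul p.1 p.2 =
        sinMul q.1 (q.2 - p.2) + (sinMul q.1 p.2 - sinMul p.1 p.2) := by
      rw [sinMul_sub]
      abel
    rw [e]
    exact (norm_add_le _ _).trans
      (add_le_add (norm_sinMul_le _ _) (norm_sinMul_sub_le _ _ _))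
  refine squeeze_zero (fun _ => norm_nonneg _) hb ?_
  have : Continuous fun q : ℝ × L1Seq d =>
      |q.1| * ‖q.2 - p.2‖ + |q.1 - p.1| * ‖p.2‖ := by fun_prop
  simpa using this.tendsto p

/-- The propagator `cos(t⟨∇⟩)` applied to a sequence of Fourier coefficients. -/
noncomputable def cosMul (t : ℝ) (f : (Fin d → ℤ) → ℂ) : L1Seq d :=
  toL1Seq fun n => (Real.cos (t * jap n) : ℂ) * f n

variable {f g : (Fin d → ℤ) → ℂ}

lemma coe_cosMul (t : ℝ) (hf : Summable fun n => ‖f n‖) :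
    ⇑(cosMul t f) = fun n => (Real.cos (t * jap n) : ℂ) * f n :=
  coe_toL1Seq (summable_norm_real_mul (fun _ => Real.abs_cos_le_one _) hf)

lemma norm_cosMul_le (t : ℝ) (hf : Summable fun n => ‖f n‖) :
    ‖cosMul t f‖ ≤ ∑' n, ‖f n‖ := by
  rw [norm_eq_tsum_norm, coe_cosMul t hf]
  simpa using tsum_norm_real_mul_le (fun n => Real.abs_cos_le_one (t * jap n)) hf

lemma cosMul_add (t : ℝ) (hf : Summable fun n => ‖f n‖) (hg : Summable fun n => ‖g n‖) :
    cosMul t (f + g) = cosMul t f + cosMul t g := by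
  have hfg : Summable fun n => ‖(f + g) n‖ :=
    Summable.of_nonneg_of_le (fun _ => norm_nonneg _) (fun _ => norm_add_le _ _) (hf.add hg)
  apply lp.ext
  rw [lp.coeFn_add, coe_cosMul t hf, coe_cosMul t hg, coe_cosMul t hfg]
  ext n
  simp only [Pi.add_apply]
  ring

lemma summable_norm_of_jap_mul (hf : Summable fun n => jap n * ‖f n‖) :
    Summable fun n => ‖f n‖ :=
  Summable.of_nonneg_of_le (fun _ => norm_nonneg _)
    (fun n => le_mul_of_one_le_left (norm_nonneg _) (one_le_jap n)) hf

lemma continuous_cosMul (hf : Summable fun n => jap n * ‖f n‖) :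
    Continuous fun t => cosMul t f := by
  have hf' := summable_norm_of_jap_mul hf
  have hb : ∀ t t', ‖cosMul t f - cosMul t' f‖ ≤ |t - t'| * ∑' n, jap n * ‖f n‖ := by
    intro t t'
    rw [norm_eq_tsum_norm, ← tsum_mul_left]
    refine (summable_norm_coe _).tsum_le_tsum (fun n => ?_) (hf.mul_left _)
    rw [lp.coeFn_sub, coe_cosMul t hf', coe_cosMul t' hf', Pi.sub_apply, ← sub_mul,
      ← Complex.ofReal_sub, norm_mul, Complex.norm_real, ← mul_assoc]
    refine mul_le_mul_of_nonneg_right ?_ (norm_nonneg _)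
    refine (Real.abs_cos_sub_cos_le _ _).trans_eq ?_
    rw [← sub_mul, abs_mul, abs_of_pos (jap_pos n)]
  refine continuous_iff_continuousAt.mpr fun t => tendsto_iff_norm_sub_tendsto_zero.mpr ?_
  refine squeeze_zero (fun _ => norm_nonneg _) (fun t' => hb t' t) ?_
  have : Continuous fun t' => |t' - t| * ∑' n, jap n * ‖f n‖ := by fun_prop
  simpa using this.tendsto t

end

/-! ### Local existence -/

section

variable {d : ℕ}

lemma continuous_duhamel {F : ℝ → L1Seq d} (hF : Continuous F) :
    Continuous fun t => ∫ s in (0 : ℝ)..t, sinMul (t - s) (F s) := by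
  refine intervalIntegral.continuous_parametric_intervalIntegral_of_continuous
    (f := fun t s => sinMul (t - s) (F s)) ?_ continuous_id
  have h : Continuous fun q : ℝ × ℝ => (q.1 - q.2, F q.2) :=
    (continuous_fst.sub continuous_snd).prodMk (hF.comp continuous_snd)
  simpa only [Function.comp_def, Function.uncurry_def] using continuous_sinMul.comp h

lemma continuous_duhamel_integrand {F : ℝ → L1Seq d} (hF : Continuous F) (t : ℝ) :
    Continuous fun s => sinMul (t - s) (F s) := by
  have h : Continuous fun s => (t - s, F s) := (continuous_const.sub continuous_id).prodMk hF
  simpa only [Function.comp_def] using continuous_sinMul.comp h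

lemma norm_duhamel_le {F : ℝ → L1Seq d} {T K : ℝ} (hF : ∀ s ∈ Set.Icc 0 T, ‖F s‖ ≤ K)
    {t : ℝ} (ht : t ∈ Set.Icc 0 T) :
    ‖∫ s in (0 : ℝ)..t, sinMul (t - s) (F s)‖ ≤ T ^ 2 * K := by
  have hK : 0 ≤ K := (norm_nonneg _).trans (hF t ht)
  have h0T : 0 ≤ T := ht.1.trans ht.2
  have h : ∀ s ∈ Set.uIoc 0 t, ‖sinMul (t - s) (F s)‖ ≤ T * K := fun s hs => by
    rw [Set.uIoc_of_le ht.1] at hs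
    refine (norm_sinMul_le _ _).trans ?_
    refine mul_le_mul ?_ (hF s ⟨hs.1.le, hs.2.trans ht.2⟩) (norm_nonneg _) h0T
    rw [abs_of_nonneg (by linarith [hs.2])]
    linarith [hs.1, ht.2]
  refine (intervalIntegral.norm_integral_le_of_norm_le_const h).trans ?_
  rw [sub_zero, abs_of_nonneg ht.1]
  calc T * K * t ≤ T * K * T := by gcongr; exact ht.2
    _ = T ^ 2 * K := by ring

/-- Local well-posedness of the Duhamel formulation of the cubic equation in `ℓ¹(ℤ^d)`. -/
theorem exists_duhamel_solution {L : ℝ → L1Seq d} (hL : Continuous L) {T B : ℝ} (hT : 0 ≤ T)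
    (hLB : ∀ t ∈ Set.Icc 0 T, ‖L t‖ ≤ B) (hTB : 24 * (T * B) ^ 2 ≤ 1) :
    ∃ u : ℝ → L1Seq d, Continuous u ∧ (∀ t, ‖u t‖ ≤ 2 * B) ∧ ∀ t ∈ Set.Icc 0 T,
      u t = L t - ∫ s in (0 : ℝ)..t, sinMul (t - s) (cube (u s)) := by
  have hB : 0 ≤ B := (norm_nonneg _).trans (hLB 0 ⟨le_rfl, hT⟩)
  let ext : C(Set.Icc 0 T, L1Seq d) → ℝ → L1Seq d := fun w => Set.IccExtend hT w
  have hext : ∀ w, Continuous (ext w) := fun w => w.continuous.Icc_extend'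
  have hextn : ∀ w t, ‖ext w t‖ ≤ ‖w‖ := fun w t => w.norm_coe_le_norm _
  have hextd : ∀ w w' t, ‖ext w t - ext w' t‖ ≤ ‖w - w'‖ := fun w w' t =>
    (w - w').norm_coe_le_norm _
  have hcub : ∀ w, Continuous fun s => cube (ext w s) := fun w => continuous_cube.comp (hext w)
  let Φ : C(Set.Icc 0 T, L1Seq d) → C(Set.Icc 0 T, L1Seq d) := fun w =>
    ⟨fun t => L t - ∫ s in (0 : ℝ)..t, sinMul (t - s) (cube (ext w s)),
      (hL.sub (continuous_duhamel (hcub w))).comp continuous_subtype_val⟩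
  have hmaps : Set.MapsTo Φ (Metric.closedBall 0 (2 * B)) (Metric.closedBall 0 (2 * B)) := by
    intro w hw
    rw [mem_closedBall_zero_iff] at hw ⊢
    rw [ContinuousMap.norm_le _ (by positivity)]
    intro t
    have h1 : ‖∫ s in (0 : ℝ)..t, sinMul (t - s) (cube (ext w s))‖ ≤ T ^ 2 * (2 * B) ^ 3 :=
      norm_duhamel_le (fun s _ => (norm_cube_le _).trans (by
        gcongr; exact (hextn w s).trans hw)) t.2
    calc ‖Φ w t‖ ≤ ‖L t‖ + ‖∫ s in (0 : ℝ)..t, sinMul (t - s) (cube (ext w s))‖ :=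
          norm_sub_le _ _
      _ ≤ B + T ^ 2 * (2 * B) ^ 3 := add_le_add (hLB t t.2) h1
      _ = B + 8 * (T * B) ^ 2 * B := by ring
      _ ≤ 2 * B := by nlinarith
  have hlip : ContractingWith (1 / 2) (hmaps.restrict Φ _ _) := by
    refine ⟨by norm_num, LipschitzWith.of_dist_le_mul fun w w' => ?_⟩
    obtain ⟨w, hw⟩ := w
    obtain ⟨w', hw'⟩ := w'
    rw [mem_closedBall_zero_iff] at hw hw'
    rw [Subtype.dist_eq, Subtype.dist_eq, Set.MapsTo.val_restrict_apply,
      Set.MapsTo.val_restrict_apply, dist_eq_norm, dist_eq_norm,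
      ContinuousMap.norm_le _ (by positivity)]
    intro t
    have e : (Φ w - Φ w') t =
        -∫ s in (0 : ℝ)..t, sinMul (t - s) (cube (ext w s) - cube (ext w' s)) := by
      change (L t - ∫ s in (0 : ℝ)..t, sinMul (t - s) (cube (ext w s))) -
        (L t - ∫ s in (0 : ℝ)..t, sinMul (t - s) (cube (ext w' s))) = _
      simp only [sinMul_sub]
      rw [intervalIntegral.integral_sub
        ((continuous_duhamel_integrand (hcub w) t).intervalIntegrable _ _)
        ((continuous_duhamel_integrand (hcub w') t).intervalIntegrable _ _)]
      abel
    rw [e, norm_neg]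
    refine (norm_duhamel_le (K := 3 * (2 * B) ^ 2 * ‖w - w'‖) (fun s _ => ?_) t.2).trans ?_
    · refine (norm_cube_sub_le ((hextn w s).trans hw) ((hextn w' s).trans hw')).trans ?_
      gcongr
      exact hextd w w' s
    · calc T ^ 2 * (3 * (2 * B) ^ 2 * ‖w - w'‖) = 12 * (T * B) ^ 2 * ‖w - w'‖ := by ring
        _ ≤ 1 / 2 * ‖w - w'‖ := by gcongr; linarith
        _ = _ := by simp
  obtain ⟨w, hw, hfix, -⟩ := hlip.exists_fixedPoint' Metric.isClosed_closedBall.isComplete hmaps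
    (x := 0) (by simp [hB]) (edist_ne_top _ _)
  rw [mem_closedBall_zero_iff] at hw
  refine ⟨ext w, hext w, fun t => (hextn w t).trans hw, fun t ht => ?_⟩
  calc ext w t = w ⟨t, ht⟩ := Set.IccExtend_of_mem hT w ht
    _ = Φ w ⟨t, ht⟩ := by rw [hfix]
    _ = _ := rfl

end

lemma duhamel_apply {d : ℕ} {F : ℝ → L1Seq d} (hF : Continuous F) (t : ℝ) (n : Fin d → ℤ) :
    (∫ s in (0 : ℝ)..t, sinMul (t - s) (F s)) n =
      ∫ s in (0 : ℝ)..t, ((Real.sin ((t - s) * jap n) / jap n : ℝ) : ℂ) * F s n := by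
  have h := (lp.evalCLM ℝ (fun _ : Fin d → ℤ => ℂ) 1 n).intervalIntegral_comp_comm
    ((continuous_duhamel_integrand hF t).intervalIntegrable (μ := MeasureTheory.volume) 0 t)
  refine h.symm.trans (intervalIntegral.integral_congr fun s _ => ?_)
  exact congrFun (coe_sinMul (t - s) (F s)) n

/-- Stability of the first Picard iterate: a solution of the Duhamel formulation stays close to
`L - ∫ sin((t-s)⟨∇⟩)/⟨∇⟩ P³` when `P` approximates the linear evolution `L`. -/
lemma norm_solution_sub_picard_le {d : ℕ} {L P u : ℝ → L1Seq d} (hP : Continuous P)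
    (hu : Continuous u) {T B M : ℝ} (hT : 0 ≤ T) (hLB : ∀ t ∈ Set.Icc 0 T, ‖L t‖ ≤ B)
    (hPB : ∀ t ∈ Set.Icc 0 T, ‖P t‖ ≤ B) (hLP : ∀ t ∈ Set.Icc 0 T, ‖L t - P t‖ ≤ M)
    (huB : ∀ t, ‖u t‖ ≤ 2 * B)
    (hsol : ∀ t ∈ Set.Icc 0 T, u t = L t - ∫ s in (0 : ℝ)..t, sinMul (t - s) (cube (u s))) :
    ‖u T - (L T - ∫ s in (0 : ℝ)..T, sinMul (T - s) (cube (P s)))‖ ≤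
      T ^ 2 * (96 * T ^ 2 * B ^ 5 + 3 * B ^ 2 * M) := by
  have hTm : T ∈ Set.Icc 0 T := ⟨hT, le_rfl⟩
  have hB : 0 ≤ B := (norm_nonneg _).trans (hLB T hTm)
  have hcu : Continuous fun s => cube (u s) := continuous_cube.comp hu
  have hcP : Continuous fun s => cube (P s) := continuous_cube.comp hP
  have huL : ∀ t ∈ Set.Icc 0 T, ‖u t - L t‖ ≤ T ^ 2 * (2 * B) ^ 3 := fun t ht => by
    rw [hsol t ht, sub_sub_cancel_left, norm_neg]
    exact norm_duhamel_le (fun s _ => (norm_cube_le _).trans (by gcongr; exact huB s)) ht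
  have e : u T - (L T - ∫ s in (0 : ℝ)..T, sinMul (T - s) (cube (P s))) =
      -∫ s in (0 : ℝ)..T, sinMul (T - s) (cube (u s) - cube (P s)) := by
    simp only [sinMul_sub]
    rw [intervalIntegral.integral_sub
      ((continuous_duhamel_integrand hcu T).intervalIntegrable _ _)
      ((continuous_duhamel_integrand hcP T).intervalIntegrable _ _), hsol T hTm]
    abel
  rw [e, norm_neg]
  refine norm_duhamel_le (fun s hs => ?_) hTm
  have hL2 : ‖L s‖ ≤ 2 * B := (hLB s hs).trans (by linarith)
  calc ‖cube (u s) - cube (P s)‖ ≤ ‖cube (u s) - cube (L s)‖ + ‖cube (L s) - cube (P s)‖ :=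
        norm_sub_le_norm_sub_add_norm_sub _ _ _
    _ ≤ 3 * (2 * B) ^ 2 * (T ^ 2 * (2 * B) ^ 3) + 3 * B ^ 2 * M := by
        refine add_le_add ((norm_cube_sub_le (huB s) hL2).trans ?_)
          ((norm_cube_sub_le (hLB s hs) (hPB s hs)).trans ?_)
        · gcongr
          exact huL s hs
        · gcongr
          exact hLP s hs
    _ = _ := by ring

/-! ### The resonant interaction -/

lemma integral_sin_sub_mul_cos {w : ℝ} (hw : 1 - w ^ 2 ≠ 0) (T : ℝ) :
    ∫ s in (0 : ℝ)..T, Real.sin (T - s) * Real.cos (w * s) =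
      (Real.cos (w * T) - Real.cos T) / (1 - w ^ 2) := by
  have hd : ∀ s : ℝ, HasDerivAt (fun s => (Real.cos (T - s) * Real.cos (w * s) -
      w * (Real.sin (T - s) * Real.sin (w * s))) / (1 - w ^ 2))
      (Real.sin (T - s) * Real.cos (w * s)) s := fun s => by
    have h1 : HasDerivAt (fun s => T - s) (-1) s := by
      simpa using (hasDerivAt_id s).const_sub T
    have h2 : HasDerivAt (fun s => w * s) w s := by
      simpa using (hasDerivAt_id s).const_mul w
    have h := (((h1.cos.mul h2.cos).sub ((h1.sin.mul h2.sin).const_mul w)).div_const (1 - w ^ 2))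
    refine h.congr_deriv ?_
    rw [div_eq_iff hw]
    ring
  rw [intervalIntegral.integral_eq_sub_of_hasDerivAt (fun s _ => hd s)
    (Continuous.intervalIntegrable (by fun_prop) _ _), ← sub_div]
  simp

/-- The resonant time integral of the product of three waves of frequencies `a`, `a`, `b`. -/
noncomputable def resonantIntegral (T a b : ℝ) : ℝ :=
  ∫ s in (0 : ℝ)..T, Real.sin (T - s) * (Real.cos (s * a) ^ 2 * Real.cos (s * b))

lemma resonantIntegral_eq {T a b : ℝ} (h1 : 1 - b ^ 2 ≠ 0) (h2 : 1 - (2 * a + b) ^ 2 ≠ 0)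
    (h3 : 1 - (2 * a - b) ^ 2 ≠ 0) :
    resonantIntegral T a b =
      1 / 2 * ((Real.cos (b * T) - Real.cos T) / (1 - b ^ 2)) +
      1 / 4 * ((Real.cos ((2 * a + b) * T) - Real.cos T) / (1 - (2 * a + b) ^ 2)) +
      1 / 4 * ((Real.cos ((2 * a - b) * T) - Real.cos T) / (1 - (2 * a - b) ^ 2)) := by
  rw [← integral_sin_sub_mul_cos h1, ← integral_sin_sub_mul_cos h2,
    ← integral_sin_sub_mul_cos h3, ← intervalIntegral.integral_const_mul,
    ← intervalIntegral.integral_const_mul, ← intervalIntegral.integral_const_mul,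
    ← intervalIntegral.integral_add (Continuous.intervalIntegrable (by fun_prop) _ _)
      (Continuous.intervalIntegrable (by fun_prop) _ _),
    ← intervalIntegral.integral_add (Continuous.intervalIntegrable (by fun_prop) _ _)
      (Continuous.intervalIntegrable (by fun_prop) _ _), resonantIntegral]
  refine intervalIntegral.integral_congr fun s _ => ?_
  have e1 : (2 * a + b) * s = 2 * (s * a) + s * b := by ring
  have e2 : (2 * a - b) * s = 2 * (s * a) - s * b := by ring
  simp only [e1, e2, Real.cos_add, Real.cos_sub, Real.cos_two_mul, mul_comm b s]
  ring

lemma tendsto_resonantIntegral (T : ℝ) {a b : ℕ → ℝ} (ha : Filter.Tendsto a .atTop .atTop)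
    (hb : Filter.Tendsto b .atTop .atTop)
    (hab : Filter.Tendsto (fun N => 2 * a N - b N) .atTop (nhds 0)) :
    Filter.Tendsto (fun N => resonantIntegral T (a N) (b N)) .atTop
      (nhds (1 / 4 * (1 - Real.cos T))) := by
  have hinf : ∀ {w : ℕ → ℝ}, Filter.Tendsto w .atTop .atTop →
      Filter.Tendsto (fun N => (Real.cos (w N * T) - Real.cos T) / (1 - w N ^ 2)) .atTop
        (nhds 0) := fun {w} hw => by
    have hw2 : Filter.Tendsto (fun N => (1 - w N ^ 2)⁻¹) .atTop (nhds 0) :=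
      (Filter.tendsto_atBot_add_const_left _ 1
        (Filter.tendsto_neg_atTop_atBot.comp
          ((Filter.tendsto_pow_atTop two_ne_zero).comp hw))).inv_tendsto_atBot
    refine squeeze_zero_norm (a := fun N => 2 * |(1 - w N ^ 2)⁻¹|) (fun N => ?_)
      (by simpa using hw2.abs.const_mul 2)
    rw [div_eq_mul_inv, norm_mul, Real.norm_eq_abs, Real.norm_eq_abs]
    gcongr
    exact (abs_sub _ _).trans (by
      linarith [Real.abs_cos_le_one (w N * T), Real.abs_cos_le_one T])
  have hw2 : Filter.Tendsto (fun N => 2 * a N + b N) .atTop .atTop :=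
    (ha.const_mul_atTop two_pos).atTop_add_atTop hb
  have h3 : Filter.Tendsto (fun N => (Real.cos ((2 * a N - b N) * T) - Real.cos T) /
      (1 - (2 * a N - b N) ^ 2)) .atTop (nhds (1 - Real.cos T)) := by
    have hc : Filter.Tendsto (fun w : ℝ => (Real.cos (w * T) - Real.cos T) / (1 - w ^ 2))
        (nhds 0) (nhds ((Real.cos (0 * T) - Real.cos T) / (1 - 0 ^ 2))) := by
      apply ContinuousAt.tendsto
      apply ContinuousAt.div (by fun_prop) (by fun_prop)
      norm_num
    simpa [Function.comp_def] using hc.comp hab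
  have hlim := (((hinf hb).const_mul (1 / 2)).add ((hinf hw2).const_mul (1 / 4))).add
    (h3.const_mul (1 / 4))
  simp only [mul_zero, zero_add] at hlim
  refine hlim.congr' ?_
  filter_upwards [hb.eventually_gt_atTop 1, hw2.eventually_gt_atTop 1,
    hab.eventually (Metric.ball_mem_nhds 0 one_pos)] with N h1 h2 h3
  rw [dist_zero_right, Real.norm_eq_abs, ← sq_lt_one_iff_abs_lt_one] at h3
  exact (resonantIntegral_eq (by nlinarith) (by nlinarith) (by linarith)).symm

lemma tendsto_resonantIntegral_sqrt (T : ℝ) :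
    Filter.Tendsto (fun N : ℕ => resonantIntegral T (Real.sqrt (1 + (N : ℝ) ^ 2))
      (Real.sqrt (1 + (2 * (N : ℝ)) ^ 2))) .atTop (nhds (1 / 4 * (1 - Real.cos T))) := by
  have hN : Filter.Tendsto (fun N : ℕ => (N : ℝ)) .atTop .atTop := tendsto_natCast_atTop_atTop
  have ha : ∀ N : ℕ, (N : ℝ) ≤ Real.sqrt (1 + (N : ℝ) ^ 2) := fun N =>
    Real.le_sqrt_of_sq_le (by linarith)
  have hb : ∀ N : ℕ, (N : ℝ) ≤ Real.sqrt (1 + (2 * (N : ℝ)) ^ 2) := fun N =>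
    Real.le_sqrt_of_sq_le (by nlinarith [sq_nonneg (N : ℝ)])
  refine tendsto_resonantIntegral T (Filter.tendsto_atTop_mono ha hN)
    (Filter.tendsto_atTop_mono hb hN) ?_
  have h3 : Filter.Tendsto (fun N : ℕ => 3 / (N : ℝ)) .atTop (nhds 0) :=
    tendsto_const_nhds.div_atTop hN
  refine squeeze_zero' (.of_forall fun N => ?_) ?_ h3
  · rw [sub_nonneg]
    refine Real.sqrt_le_iff.mpr ⟨by positivity, ?_⟩
    nlinarith [Real.sq_sqrt (show 0 ≤ 1 + (N : ℝ) ^ 2 by positivity)]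
  · filter_upwards [Filter.eventually_gt_atTop 0] with N hN0
    have hN1 : (0 : ℝ) < N := by exact_mod_cast hN0
    rw [le_div_iff₀ hN1]
    have h1 := Real.sq_sqrt (show 0 ≤ 1 + (N : ℝ) ^ 2 by positivity)
    have h2 := Real.sq_sqrt (show 0 ≤ 1 + (2 * (N : ℝ)) ^ 2 by positivity)
    have h1' := ha N
    have h2' := hb N
    set a := Real.sqrt (1 + (N : ℝ) ^ 2)
    set b := Real.sqrt (1 + (2 * (N : ℝ)) ^ 2)
    have h4 : (2 * a - b) * (2 * a + b) = 3 := by nlinarith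
    have h5 : 0 ≤ 2 * a - b := by
      by_contra! hneg
      nlinarith
    nlinarith

/-! ### The high-frequency perturbation -/

lemma dconv_eq_sum_multiples {d : ℕ} {p : Fin d → ℤ} (hp : p ≠ 0) {f g : (Fin d → ℤ) → ℂ}
    (hf : ∀ n, n ∉ Set.range (fun k : ℤ => k • p) → f n = 0) (s : Finset ℤ)
    (hs : ∀ k ∉ s, f (k • p) = 0) (k : ℤ) :
    dconv f g (k • p) = ∑ j ∈ s, f (j • p) * g ((k - j) • p) := by
  have hinj : Function.Injective fun k : ℤ => k • p := smul_left_injective ℤ hp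
  rw [dconv, ← hinj.tsum_eq, tsum_eq_sum (s := s)]
  · simp only [sub_smul]
  · intro j hj
    rw [hs j hj, zero_mul]
  · intro n hn
    by_contra h
    exact hn (by simp [hf n h])

lemma dcube_zero_of_four_modes {d : ℕ} {p : Fin d → ℤ} (hp : p ≠ 0) {f : (Fin d → ℤ) → ℂ}
    {a b : ℂ} (hf : ∀ n, n ∉ Set.range (fun k : ℤ => k • p) → f n = 0)
    (hfk : ∀ k : ℤ, f (k • p) = if k.natAbs = 1 then a else if k.natAbs = 2 then b else 0) :
    dcube f 0 = 6 * (a ^ 2 * b) := by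
  have hinj : Function.Injective fun k : ℤ => k • p := smul_left_injective ℤ hp
  let s : Finset ℤ := {-2, -1, 1, 2}
  have hs : ∀ k ∉ s, f (k • p) = 0 := fun k hk => by
    rw [hfk, if_neg, if_neg] <;> simp only [s, Finset.mem_insert, Finset.mem_singleton] at hk <;>
      omega
  have h1 : dcube f 0 = ∑ k ∈ s, dconv f f (k • p) * f ((-k) • p) := by
    rw [dcube]
    change ∑' m, dconv f f m * f (0 - m) = _
    rw [← hinj.tsum_eq, tsum_eq_sum (s := s)]
    · simp
    · intro j hj
      have : f ((-j) • p) = 0 := hs _ fun h => hj (by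
        simp only [s, Finset.mem_insert, Finset.mem_singleton] at h ⊢
        omega)
      rw [zero_sub, ← neg_smul, this, mul_zero]
    · intro n hn
      by_contra h
      refine hn ?_
      have : f (0 - n) = 0 := hf _ fun ⟨k, hk⟩ => h ⟨-k, by
        simp only [zero_sub, neg_smul] at hk ⊢
        rw [hk, neg_neg]⟩
      change dconv f f n * f (0 - n) = 0
      rw [this, mul_zero]
  rw [h1]
  simp only [dconv_eq_sum_multiples hp hf s hs, hfk]
  simp [s]
  ring

/-- The frequencies `±p`, `±2p`. -/
def fourFreqs {d : ℕ} (p : Fin d → ℤ) : Finset (Fin d → ℤ) :=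
  ({-2, -1, 1, 2} : Finset ℤ).image fun k => k • p

/-- The sequence equal to `A` at the frequencies `±p`, `±2p` and zero elsewhere. -/
def fourModes {d : ℕ} (p : Fin d → ℤ) (A : ℝ) : (Fin d → ℤ) → ℂ :=
  fun n => if n ∈ fourFreqs p then (A : ℂ) else 0

section

variable {d : ℕ} {p : Fin d → ℤ}

lemma mem_fourFreqs {n : Fin d → ℤ} :
    n ∈ fourFreqs p ↔ ∃ k : ℤ, (k.natAbs = 1 ∨ k.natAbs = 2) ∧ k • p = n := by
  simp only [fourFreqs, Finset.mem_image, Finset.mem_insert, Finset.mem_singleton]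
  refine exists_congr fun k => and_congr_left fun _ => ?_
  omega

lemma neg_mem_fourFreqs {n : Fin d → ℤ} (h : n ∈ fourFreqs p) : -n ∈ fourFreqs p := by
  obtain ⟨k, hk, rfl⟩ := mem_fourFreqs.mp h
  exact mem_fourFreqs.mpr ⟨-k, by simpa using hk, neg_smul _ _⟩

lemma card_fourFreqs_le : (fourFreqs p).card ≤ 4 :=
  Finset.card_image_le.trans (by simp)

lemma smul_mem_fourFreqs (hp : p ≠ 0) {k : ℤ} :
    k • p ∈ fourFreqs p ↔ k.natAbs = 1 ∨ k.natAbs = 2 := by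
  rw [mem_fourFreqs]
  refine ⟨?_, fun h => ⟨k, h, rfl⟩⟩
  rintro ⟨j, hj, h⟩
  rwa [← smul_left_injective ℤ hp h]

variable (A : ℝ)

lemma fourModes_neg (n : Fin d → ℤ) : fourModes p A (-n) = fourModes p A n := by
  have : -n ∈ fourFreqs p ↔ n ∈ fourFreqs p :=
    ⟨fun h => by simpa using neg_mem_fourFreqs h, neg_mem_fourFreqs⟩
  simp only [fourModes, this]

lemma conj_fourModes (n : Fin d → ℤ) :
    starRingEnd ℂ (fourModes p A n) = fourModes p A n := by
  rw [fourModes]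
  split_ifs <;> simp

lemma fourModes_of_notMem {n : Fin d → ℤ} (h : n ∉ fourFreqs p) : fourModes p A n = 0 :=
  if_neg h

lemma fourModes_smul (hp : p ≠ 0) (k : ℤ) :
    fourModes p A (k • p) = if k.natAbs = 1 ∨ k.natAbs = 2 then (A : ℂ) else 0 := by
  simp only [fourModes, smul_mem_fourFreqs hp]

lemma fourModes_zero (hp : p ≠ 0) : fourModes p A 0 = 0 := by
  simpa using fourModes_smul A hp 0

lemma fourModes_of_notMem_range {n : Fin d → ℤ} (h : n ∉ Set.range fun k : ℤ => k • p) :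
    fourModes p A n = 0 :=
  fourModes_of_notMem A fun hn => h <| by
    obtain ⟨k, -, hk⟩ := mem_fourFreqs.mp hn
    exact ⟨k, hk⟩

lemma norm_fourModes_le (hA : 0 ≤ A) (n : Fin d → ℤ) : ‖fourModes p A n‖ ≤ A := by
  rw [fourModes]
  split_ifs
  · simp [abs_of_nonneg hA]
  · simpa using hA

lemma summable_mul_norm_fourModes_pow (c : (Fin d → ℤ) → ℝ) {k : ℕ} (hk : k ≠ 0) :
    Summable fun n => c n * ‖fourModes p A n‖ ^ k :=
  summable_of_ne_finset_zero (s := fourFreqs p) fun n hn => by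
    simp [fourModes_of_notMem A hn, hk]

lemma summable_norm_fourModes : Summable fun n => ‖fourModes p A n‖ := by
  simpa using summable_mul_norm_fourModes_pow (p := p) A (fun _ => 1) one_ne_zero

lemma tsum_norm_fourModes_le (hA : 0 ≤ A) : ∑' n, ‖fourModes p A n‖ ≤ 4 * A := by
  rw [tsum_eq_sum (s := fourFreqs p) fun n hn => by simp [fourModes_of_notMem A hn]]
  refine (Finset.sum_le_card_nsmul _ _ A fun n _ => norm_fourModes_le A hA n).trans ?_
  rw [nsmul_eq_mul]
  gcongr
  exact_mod_cast card_fourFreqs_le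

lemma hsum_fourModes_le {s N : ℝ} (hs : s < 0) (hN : 0 < N) (hA : 0 ≤ A)
    (hpN : ∀ n ∈ fourFreqs p, N ≤ jap n) :
    hsum s (fourModes p A) ≤ 4 * (N ^ (2 * s) * A ^ 2) := by
  rw [hsum, tsum_eq_sum (s := fourFreqs p) fun n hn => by simp [fourModes_of_notMem A hn]]
  refine (Finset.sum_le_card_nsmul _ _ (N ^ (2 * s) * A ^ 2) fun n hn => ?_).trans ?_
  · have := norm_fourModes_le (p := p) A hA n
    have h2 : jap n ^ (2 * s) ≤ N ^ (2 * s) :=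
      Real.rpow_le_rpow_of_nonpos hN (hpN n hn) (by linarith)
    gcongr
  · rw [nsmul_eq_mul]
    gcongr
    exact_mod_cast card_fourFreqs_le

lemma picard_fourModes_zero (hp : p ≠ 0) (T : ℝ) :
    (∫ s in (0 : ℝ)..T, sinMul (T - s) (cube (cosMul s (fourModes p A)))) 0 =
      ((6 * A ^ 3 * resonantIntegral T (jap p) (jap ((2 : ℤ) • p)) : ℝ) : ℂ) := by
  have hs := summable_norm_fourModes (p := p) A
  have hc : Continuous fun s => cube (cosMul s (fourModes p A)) :=
    continuous_cube.comp (continuous_cosMul (by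
      simpa using summable_mul_norm_fourModes_pow (p := p) A jap one_ne_zero))
  rw [duhamel_apply hc, resonantIntegral, ← intervalIntegral.integral_const_mul,
    ← intervalIntegral.integral_ofReal]
  refine intervalIntegral.integral_congr fun s _ => ?_
  have h : dcube (cosMul s (fourModes p A)) 0 =
      6 * (((Real.cos (s * jap p) : ℂ) * A) ^ 2 *
        ((Real.cos (s * jap ((2 : ℤ) • p)) : ℂ) * A)) := by
    refine dcube_zero_of_four_modes hp (fun n hn => ?_) fun k => ?_
    · rw [coe_cosMul s hs]
      simp only [fourModes_of_notMem_range A hn, mul_zero]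
    · rw [coe_cosMul s hs]
      simp only [fourModes_smul A hp]
      by_cases h1 : k.natAbs = 1
      · rcases Int.natAbs_eq_iff.mp h1 with rfl | rfl <;> simp [jap_neg]
      by_cases h2 : k.natAbs = 2
      · rcases Int.natAbs_eq_iff.mp h2 with rfl | rfl <;> simp [jap_neg]
      simp [h1, h2]
  simp only [coe_cube, h, jap_zero, mul_one, div_one]
  push_cast
  ring

end

lemma jap_smul_single {d : ℕ} (i : Fin d) (N : ℕ) (k : ℤ) :
    jap (k • (Pi.single i (N : ℤ) : Fin d → ℤ)) = Real.sqrt (1 + (k * (N : ℝ)) ^ 2) := by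
  rw [jap, Finset.sum_eq_single i]
  · simp
  · intro j _ hj
    simp [hj]
  · simp

lemma le_jap_of_mem_fourFreqs {d : ℕ} (i : Fin d) (N : ℕ) {n : Fin d → ℤ}
    (hn : n ∈ fourFreqs (Pi.single i (N : ℤ) : Fin d → ℤ)) : (N : ℝ) ≤ jap n := by
  obtain ⟨k, hk, rfl⟩ := mem_fourFreqs.mp hn
  rw [jap_smul_single]
  refine Real.le_sqrt_of_sq_le ?_
  have h1 : (1 : ℝ) ≤ (k : ℝ) ^ 2 := by
    have : 1 ≤ k ^ 2 := by
      rw [one_le_sq_iff_one_le_abs, Int.abs_eq_natAbs]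
      omega
    exact_mod_cast this
  nlinarith [sq_nonneg (N : ℝ)]

/-- The linear evolution, with values in `ℓ¹(ℤ^d)`. -/
noncomputable def linEvol {d : ℕ} (v₀ v₁ : (Fin d → ℤ) → ℂ) (t : ℝ) : L1Seq d :=
  cosMul t v₀ + sinMul t (toL1Seq v₁)

lemma continuous_linEvol {d : ℕ} {v₀ v₁ : (Fin d → ℤ) → ℂ}
    (h₀ : Summable fun n => jap n * ‖v₀ n‖) : Continuous (linEvol v₀ v₁) := by
  have h : Continuous fun t : ℝ => (t, toL1Seq v₁) := by fun_prop
  exact (continuous_cosMul h₀).add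
    (by simpa only [Function.comp_def] using continuous_sinMul.comp h)

lemma norm_linEvol_le {d : ℕ} {v₀ v₁ : (Fin d → ℤ) → ℂ} (h₀ : Summable fun n => ‖v₀ n‖)
    (h₁ : Summable fun n => ‖v₁ n‖) {t : ℝ} (ht : |t| ≤ 1) :
    ‖linEvol v₀ v₁ t‖ ≤ ∑' n, ‖v₀ n‖ + ∑' n, ‖v₁ n‖ := by
  refine (norm_add_le _ _).trans (add_le_add (norm_cosMul_le t h₀) ?_)
  rw [← norm_toL1Seq h₁]
  exact (norm_sinMul_le _ _).trans (mul_le_of_le_one_left (norm_nonneg _) ht)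

/-- A continuous solution of the Duhamel formulation in `ℓ¹(ℤ^d)` solves the cubic equation
coefficientwise. -/
lemma solvesNLW_of_duhamel {d : ℕ} {v₀ v₁ : (Fin d → ℤ) → ℂ} (h₀ : Summable fun n => ‖v₀ n‖)
    (h₁ : Summable fun n => ‖v₁ n‖) {T : ℝ} {u : ℝ → L1Seq d} (hu : Continuous u)
    (hsol : ∀ t ∈ Set.Icc 0 T,
      u t = linEvol v₀ v₁ t - ∫ s in (0 : ℝ)..t, sinMul (t - s) (cube (u s))) :
    SolvesNLW (Set.Icc 0 T) v₀ v₁ fun t => u t := by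
  refine ⟨⟨fun t _ => summable_norm_coe (u t), fun t _ ε hε => ?_⟩, fun t ht n => ?_⟩
  · obtain ⟨δ, hδ, h⟩ := Metric.continuous_iff.mp hu t ε hε
    refine ⟨δ, hδ, fun s _ hs => ?_⟩
    have := h s (by rwa [Real.dist_eq])
    rw [dist_eq_norm, norm_eq_tsum_norm] at this
    simpa using this
  · have h := duhamel_apply (continuous_cube.comp hu) t n
    simp only [Function.comp_apply, coe_cube] at h
    rw [← h]
    change u t n = _
    rw [hsol t ht, lp.coeFn_sub, Pi.sub_apply, linEvol, lp.coeFn_add, Pi.add_apply,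
      coe_cosMul t h₀, coe_sinMul, coe_toL1Seq h₁]

lemma norm_apply_zero_le_sqrt_hsum {d : ℕ} {s : ℝ} (hs : s < 0) (x : L1Seq d) :
    ‖x 0‖ ≤ Real.sqrt (hsum s x) := by
  have hj : ∀ n : Fin d → ℤ, jap n ^ (2 * s) ≤ 1 := fun n =>
    Real.rpow_le_one_of_one_le_of_nonpos (one_le_jap n) (by linarith)
  have hj0 : ∀ n : Fin d → ℤ, 0 ≤ jap n ^ (2 * s) := fun n =>
    Real.rpow_nonneg (jap_pos n).le _
  have hsum' : Summable fun n => jap n ^ (2 * s) * ‖x n‖ ^ 2 := by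
    refine Summable.of_nonneg_of_le (fun n => mul_nonneg (hj0 n) (sq_nonneg _)) (fun n => ?_)
      ((summable_norm_coe x).mul_left ‖x‖)
    have h1 : ‖x n‖ ≤ ‖x‖ := lp.norm_apply_le_norm one_ne_zero x n
    calc jap n ^ (2 * s) * ‖x n‖ ^ 2 ≤ 1 * ‖x n‖ ^ 2 := by gcongr; exact hj n
      _ = ‖x n‖ * ‖x n‖ := by ring
      _ ≤ ‖x‖ * ‖x n‖ := by gcongr
  refine Real.le_sqrt_of_sq_le ?_
  have := hsum'.le_tsum 0 fun n _ => mul_nonneg (hj0 n) (sq_nonneg _)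
  simpa [jap_zero, hsum] using this

/-- Quantitative growth of the zero mode for smooth data perturbed by four large modes. -/
lemma exists_solution_zero_mode_ge {d : ℕ} {u₀ u₁ : (Fin d → ℤ) → ℂ}
    (h₀ : Summable fun n => jap n * ‖u₀ n‖) (h₁ : Summable fun n => ‖u₁ n‖) {A T : ℝ}
    (hA : 1 ≤ A) (hMA : ∑' n, ‖u₀ n‖ + ∑' n, ‖u₁ n‖ ≤ A) (hT : T * A = 1 / 10000)
    {p : Fin d → ℤ} (hp : p ≠ 0)
    (hres : T ^ 2 / 32 ≤ resonantIntegral T (jap p) (jap ((2 : ℤ) • p))) :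
    ∃ u : ℝ → L1Seq d, SolvesNLW (Set.Icc 0 T) (u₀ + fourModes p A) u₁ (fun t => u t) ∧
      A / 10 ^ 9 - 2 * (∑' n, ‖u₀ n‖ + ∑' n, ‖u₁ n‖) ≤ ‖u T 0‖ := by
  set M := ∑' n, ‖u₀ n‖ + ∑' n, ‖u₁ n‖ with hM
  have hM0 : 0 ≤ M :=
    add_nonneg (tsum_nonneg fun _ => norm_nonneg _) (tsum_nonneg fun _ => norm_nonneg _)
  have hA0 : 0 ≤ A := by linarith
  have hT0 : 0 ≤ T := by
    by_contra! h
    nlinarith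
  have hT1 : T ≤ 1 := by nlinarith
  have hφ := summable_norm_fourModes (p := p) A
  have hφj : Summable fun n => jap n * ‖fourModes p A n‖ := by
    simpa using summable_mul_norm_fourModes_pow (p := p) A jap one_ne_zero
  have h₀' := summable_norm_of_jap_mul h₀
  have hv : Summable fun n => jap n * ‖(u₀ + fourModes p A) n‖ :=
    Summable.of_nonneg_of_le (fun n => mul_nonneg (jap_pos n).le (norm_nonneg _))
      (fun n => (mul_le_mul_of_nonneg_left (norm_add_le _ _) (jap_pos n).le).trans_eq
        (mul_add _ _ _)) (h₀.add hφj)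
  set P : ℝ → L1Seq d := fun t => cosMul t (fourModes p A) with hPdef
  set L : ℝ → L1Seq d := linEvol (u₀ + fourModes p A) u₁ with hLdef
  have hPc : Continuous P := continuous_cosMul hφj
  have hLPe : ∀ t, L t - P t = linEvol u₀ u₁ t := fun t => by
    simp only [hPdef, hLdef, linEvol, cosMul_add t h₀' hφ]
    abel
  have habs : ∀ t ∈ Set.Icc 0 T, |t| ≤ 1 := fun t ht => by
    rw [abs_of_nonneg ht.1]
    exact ht.2.trans hT1
  have hLP : ∀ t ∈ Set.Icc 0 T, ‖L t - P t‖ ≤ M := fun t ht => by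
    rw [hLPe]
    exact norm_linEvol_le h₀' h₁ (habs t ht)
  have hP4 : ∀ t, ‖P t‖ ≤ 4 * A := fun t =>
    (norm_cosMul_le t hφ).trans (tsum_norm_fourModes_le A hA0)
  have hLB : ∀ t ∈ Set.Icc 0 T, ‖L t‖ ≤ 5 * A := fun t ht => by
    have := norm_le_norm_add_norm_sub (P t) (L t)
    rw [norm_sub_rev] at this
    linarith [hLP t ht, hP4 t]
  obtain ⟨u, hu, huB, hsol⟩ := exists_duhamel_solution (continuous_linEvol hv) hT0 hLB (by
    rw [show T * (5 * A) = 5 * (T * A) by ring, hT]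
    norm_num)
  refine ⟨u, solvesNLW_of_duhamel (summable_norm_of_jap_mul hv) h₁ hu hsol, ?_⟩
  have hstab := norm_solution_sub_picard_le hPc hu hT0 hLB
    (fun t _ => (hP4 t).trans (by linarith)) hLP huB hsol
  have herr : T ^ 2 * (96 * T ^ 2 * (5 * A) ^ 5 + 3 * (5 * A) ^ 2 * M) =
      300000 * (T * A) ^ 4 * A + 75 * (T * A) ^ 2 * M := by ring
  rw [herr, hT] at hstab
  have hz := (lp.norm_apply_le_norm one_ne_zero _ (0 : Fin d → ℤ)).trans hstab
  set D : L1Seq d := ∫ s in (0 : ℝ)..T, sinMul (T - s) (cube (P s)) with hD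
  have hD0 : D 0 = ((6 * A ^ 3 * resonantIntegral T (jap p) (jap ((2 : ℤ) • p)) : ℝ) : ℂ) :=
    picard_fourModes_zero A hp T
  have hDn : 3 / 16 * (T * A) ^ 2 * A ≤ ‖D 0‖ := by
    rw [hD0, Complex.norm_real]
    refine le_trans ?_ (le_abs_self _)
    calc 3 / 16 * (T * A) ^ 2 * A = 6 * A ^ 3 * (T ^ 2 / 32) := by ring
      _ ≤ _ := by gcongr
  rw [hT] at hDn
  have hP0 : P T 0 = 0 := by
    rw [hPdef]
    simp only [coe_cosMul T hφ, fourModes_zero A hp, mul_zero]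
  have hL0 : ‖L T 0‖ ≤ M := by
    have h := (lp.norm_apply_le_norm one_ne_zero _ (0 : Fin d → ℤ)).trans (hLP T ⟨hT0, le_rfl⟩)
    rwa [lp.coeFn_sub, Pi.sub_apply, hP0, sub_zero] at h
  simp only [lp.coeFn_sub, Pi.sub_apply] at hz
  have htri : ‖D 0‖ ≤ ‖u T 0 - (L T 0 - D 0)‖ + ‖L T 0‖ + ‖u T 0‖ := by
    have e : D 0 = (u T 0 - (L T 0 - D 0)) + L T 0 - u T 0 := by ring
    calc ‖D 0‖ = ‖(u T 0 - (L T 0 - D 0)) + L T 0 - u T 0‖ := by rw [← e]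
      _ ≤ _ := (norm_sub_le _ _).trans (add_le_add_left (norm_add_le _ _) _)
  norm_num at hz hDn ⊢
  linarith

/-- Norm inflation at every smooth initial datum for the cubic NLW on `𝕋^d`
in `H^s × H^{s-1}` for `s < 0` (with additionally `s ≤ -1/2` when `d = 1`). -/
theorem nlw_norm_inflation_smooth_data (d : ℕ) (hd : 1 ≤ d) (s : ℝ) (hs : s < 0)
    (hd1 : d = 1 → s ≤ -(1 / 2))
    (u₀ u₁ : (Fin d → ℤ) → ℂ)
    (hreal₀ : ∀ n, u₀ (-n) = starRingEnd ℂ (u₀ n))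
    (hreal₁ : ∀ n, u₁ (-n) = starRingEnd ℂ (u₁ n))
    (hsmooth : ∀ k : ℕ, ∃ C : ℝ, ∀ n, (jap n) ^ k * (‖u₀ n‖ + ‖u₁ n‖) ≤ C) :
    ∀ m : ℕ, 1 ≤ m → ∃ (v₀ v₁ : (Fin d → ℤ) → ℂ) (tm : ℝ) (u : ℝ → (Fin d → ℤ) → ℂ),
      (∀ n, v₀ (-n) = starRingEnd ℂ (v₀ n)) ∧
      (∀ n, v₁ (-n) = starRingEnd ℂ (v₁ n)) ∧
      Summable (fun n => ‖v₀ n‖ + (jap n)⁻¹ * ‖v₁ n‖) ∧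
      0 < tm ∧ tm < 1 / (m : ℝ) ∧
      SolvesNLW (Set.Icc 0 tm) v₀ v₁ u ∧
      Summable (fun n => (jap n) ^ (2 * s) * ‖v₀ n - u₀ n‖ ^ 2) ∧
      Summable (fun n => (jap n) ^ (2 * (s - 1)) * ‖v₁ n - u₁ n‖ ^ 2) ∧
      Real.sqrt (hsum s (fun n => v₀ n - u₀ n) + hsum (s - 1) (fun n => v₁ n - u₁ n))
        < 1 / (m : ℝ) ∧
      Real.sqrt (hsum s (u tm)) > (m : ℝ) := by
  intro m hm
  have hdec : ∀ f : (Fin d → ℤ) → ℂ, (∀ n, ‖f n‖ ≤ ‖u₀ n‖ + ‖u₁ n‖) →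
      Summable fun n => jap n * ‖f n‖ := fun f hf =>
    summable_jap_mul_of_decay fun k => by
      obtain ⟨C, hC⟩ := hsmooth k
      exact ⟨C, fun n => (mul_le_mul_of_nonneg_left (hf n)
        (pow_nonneg (jap_pos n).le k)).trans (hC n)⟩
  have h₀ := hdec u₀ fun n => le_add_of_nonneg_right (norm_nonneg _)
  have h₁ := summable_norm_of_jap_mul (hdec u₁ fun n => le_add_of_nonneg_left (norm_nonneg _))
  have hm1 : (1 : ℝ) ≤ m := by exact_mod_cast hm
  set M := ∑' n, ‖u₀ n‖ + ∑' n, ‖u₁ n‖ with hM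
  have hM0 : 0 ≤ M :=
    add_nonneg (tsum_nonneg fun _ => norm_nonneg _) (tsum_nonneg fun _ => norm_nonneg _)
  obtain ⟨A, hAdef⟩ : ∃ A : ℝ, A = 10 ^ 10 * (m + M) := ⟨_, rfl⟩
  have hAm : (m : ℝ) ≤ A := by linarith
  have hA1 : 1 ≤ A := hm1.trans hAm
  have hA0 : 0 < A := by linarith
  obtain ⟨T, hTdef⟩ : ∃ T : ℝ, T = 1 / 10000 / A := ⟨_, rfl⟩
  have hTA : T * A = 1 / 10000 := by rw [hTdef, div_mul_cancel₀ _ hA0.ne']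
  have hT0 : 0 < T := by rw [hTdef]; positivity
  have hT1 : T ≤ 1 := by nlinarith
  have hTm : T < 1 / (m : ℝ) := by
    rw [lt_div_iff₀ (by linarith)]
    nlinarith
  have hcos : T ^ 2 / 32 < 1 / 4 * (1 - Real.cos T) := by
    have h1 := (abs_le.mp (Real.cos_bound (x := T) (by rwa [abs_of_pos hT0]))).2
    rw [abs_of_pos hT0] at h1
    have h2 : T ^ 4 ≤ T ^ 2 := pow_le_pow_of_le_one hT0.le hT1 (by norm_num)
    have h3 : 0 < T ^ 2 := by positivity
    linarith
  have hsmall : Filter.Tendsto (fun N : ℕ => 4 * ((N : ℝ) ^ (2 * s) * A ^ 2)) .atTop (nhds 0) := by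
    have h := (tendsto_rpow_neg_atTop (y := -(2 * s)) (by linarith)).comp
      tendsto_natCast_atTop_atTop
    simp only [neg_neg, Function.comp_def] at h
    simpa using (h.mul_const (A ^ 2)).const_mul 4
  obtain ⟨N, hN0, hNres, hNsmall⟩ := ((Filter.eventually_gt_atTop 0).and
    (((tendsto_resonantIntegral_sqrt T).eventually_const_lt hcos).and
      (hsmall.eventually_lt_const (show 0 < (1 / (m : ℝ)) ^ 2 by positivity)))).exists
  let i : Fin d := ⟨0, hd⟩
  let p : Fin d → ℤ := Pi.single i (N : ℤ)
  have hp : p ≠ 0 := by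
    rw [Ne, Pi.single_eq_zero_iff]
    exact_mod_cast hN0.ne'
  have hjp : jap p = Real.sqrt (1 + (N : ℝ) ^ 2) := by
    simpa [p] using jap_smul_single i N 1
  have hj2p : jap ((2 : ℤ) • p) = Real.sqrt (1 + (2 * (N : ℝ)) ^ 2) := by
    simpa only [Int.cast_ofNat] using jap_smul_single i N 2
  obtain ⟨u, hu, huT⟩ := exists_solution_zero_mode_ge h₀ h₁ hA1 (by linarith) hTA hp
    (by rw [hjp, hj2p]; exact hNres.le)
  have hdiff₀ : (fun n => (u₀ + fourModes p A) n - u₀ n) = fourModes p A := by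
    ext n
    simp
  have hdiff₁ : hsum (s - 1) (fun n => u₁ n - u₁ n) = 0 := by simp [hsum]
  refine ⟨u₀ + fourModes p A, u₁, T, fun t => u t, fun n => ?_, hreal₁, ?_, hT0, hTm, hu, ?_, ?_,
    ?_, ?_⟩
  · simp only [Pi.add_apply, map_add, hreal₀, fourModes_neg, conj_fourModes]
  · have hv₀ : Summable fun n => ‖(u₀ + fourModes p A) n‖ :=
      Summable.of_nonneg_of_le (fun _ => norm_nonneg _) (fun _ => norm_add_le _ _)
        ((summable_norm_of_jap_mul h₀).add (summable_norm_fourModes A))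
    refine hv₀.add (Summable.of_nonneg_of_le (fun n => ?_) (fun n => ?_) h₁)
    · exact mul_nonneg (inv_nonneg.mpr (jap_pos n).le) (norm_nonneg _)
    · exact mul_le_of_le_one_left (norm_nonneg _) (inv_le_one_of_one_le₀ (one_le_jap n))
  · simpa using summable_mul_norm_fourModes_pow (p := p) A (fun n => jap n ^ (2 * s)) two_ne_zero
  · simp
  · rw [hdiff₀, hdiff₁, add_zero, Real.sqrt_lt' (by positivity)]
    exact (hsum_fourModes_le A hs (by exact_mod_cast hN0) hA0.le
      fun n hn => le_jap_of_mem_fourFreqs i N hn).trans_lt hNsmall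
  · refine lt_of_lt_of_le ?_ (norm_apply_zero_le_sqrt_hsum hs (u T))
    refine lt_of_lt_of_le ?_ huT
    rw [hAdef]
    norm_num
    linarith
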